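/- Let P = (V,C,ν,σ) be a case of 3-SAT, let m_P be the associated midpoints structure on X, and let t be a tree realization of m_P. Then for every clause c ∈ [1,C] there exists a ∈ [0,2] with τ_{ν(c,a),σ(c,a)} > 0. -/

import Mathlib

open Classical

/-- `sel S e` is `S¹ = S` for `e = true` and `Sᶜ = X∖S` for `e = false`. -/
def sel {X : Type*} (S : Set X) (e : Bool) : Set X := if e then S else Sᶜ

/-- The closed interval `[S,T] = {U ⊆ X | S^e ⊆ U^g ⊆ T^f for some e, f, g ∈ {1,c}}`. -/
def icc {X : Type*} (S T : Set X) : Set (Set X) :=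
  {U | ∃ e f g : Bool, sel S e ⊆ sel U g ∧ sel U g ⊆ sel T f}

/-- The half-open interval `[S,T) = [S,T] ∖ {T}`. -/
def ico {X : Type*} (S T : Set X) : Set (Set X) := icc S T \ {T}

/-- The open interval `(S,T) = [S,T] ∖ {S, Sᶜ, T, Tᶜ}`. -/
def ioo {X : Type*} (S T : Set X) : Set (Set X) := icc S T \ {S, Sᶜ, T, Tᶜ}

/-- `t_W = Σ_{S ∈ W} t(S)` for a family `W` of subsets. -/
noncomputable def tW {X : Type*} (t : Set X → ℝ) (W : Set (Set X)) : ℝ :=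
  ∑ᶠ U ∈ W, t U

/-- A midpoints structure on a linearly ordered set `X`, given as a symmetric map
assigning to each (unordered) pair `{x,y}` a subset `m x y ⊆ X` such that
`{x,y} ∩ m x y = {max x y}` for `x ≠ y`. -/
def IsMidpoints {X : Type*} [LinearOrder X] (m : X → X → Set X) : Prop :=
  (∀ x y : X, m x y = m y x) ∧
  (∀ x y : X, x ≠ y → ({x, y} : Set X) ∩ m x y = {max x y})

/-- `t ∈ ℝ^{2^X}` is a tree realization of the midpoints structure `m`:
(1) `t(S) = t(Sᶜ) ≥ 0`; (2) if all four intersections `S^e ∩ T^f` are nonempty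
then `t(S)·t(T) = 0`; (3) for `x ≠ x'`, `t_{[{x},m{x,x'}]} > t_{[{x'},m{x,x'})}`. -/
def IsTreeRealization {X : Type*} (m : X → X → Set X) (t : Set X → ℝ) : Prop :=
  (∀ S : Set X, t S = t Sᶜ ∧ 0 ≤ t S) ∧
  (∀ S T : Set X, (∀ e f : Bool, (sel S e ∩ sel T f).Nonempty) → t S * t T = 0) ∧
  (∀ x x' : X, x ≠ x' → tW t (ico {x'} (m x x')) < tW t (icc {x} (m x x')))

/-! ## The 3-SAT encoding

A case of 3-SAT `P = (V,C,ν,σ)` is encoded with `ν : Fin C → Fin 3 → Fin (V+2)`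
(the variable `ν c a ∈ [1,V]` of clause `c`, hypotheses `1 ≤ ν c a ≤ V` and
`ν c 0 < ν c 1 < ν c 2` are stated separately) and signs
`σ : Fin C → Fin 3 → Bool` (`true` for `+1`, `false` for `−1`). -/

/-- `X₀ = {x_{v,s} | v ∈ [0,V+1], s ∈ {−1,1}}`, with `x_{v,s}` encoded as `(v,s)`
with `s : Bool` (`false` for `−1`, `true` for `+1`). -/
abbrev X₀ (V : ℕ) := Fin (V + 2) × Bool

/-- `Y = [0,3] × [0,3] × [−1,1]`, an element `(p,q,e)` encoded with
`e : Fin 3` (`0` for `−1`, `1` for `0`, `2` for `+1`). -/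
abbrev Yc := Fin 4 × Fin 4 × Fin 3

/-- The underlying set `X = X₀ ∪ X₁ ∪ ⋯ ∪ X_C` of `m_P`, an element of `X_c`
(`c ∈ [1,C]`) encoded as `Sum.inr (c, (p,q,e))` with `c : Fin C`. -/
abbrev XP (V C : ℕ) := X₀ V ⊕ (Fin C × Yc)

/-- The rank of `x_{v,s}` in the lexicographic order on `X₀`. -/
def key {V : ℕ} (x : X₀ V) : ℕ := 2 * (x.1 : ℕ) + (if x.2 then 1 else 0)

/-- The sign `s ∈ {−1,+1}` encoded by a Boolean. -/
def sgn (b : Bool) : ℤ := if b then 1 else -1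

/-- The midpoints structure `m₀` on `X₀`: for `x_{v',s'} < x_{v,s}`,
`m₀{x_{v',s'},x_{v,s}} = {x_{u,r} | u ≥ v}` if `2v'+s' = 2v+s` and `v' < v`, and
`= {x_{v,s}}` if `2v'+s' < 2v+s`. -/
def m₀ {V : ℕ} (a b : X₀ V) : Set (X₀ V) :=
  let big := if key a ≤ key b then b else a
  let small := if key a ≤ key b then a else b
  if 2 * (small.1 : ℤ) + sgn small.2 = 2 * (big.1 : ℤ) + sgn big.2 ∧ small.1 < big.1
  then {x : X₀ V | big.1 ≤ x.1}
  else {big}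

/-- The rank of `(q,e)` in the total order
`(0,0)<(1,0)<(0,1)<(1,−1)<(2,0)<(1,1)<(2,−1)<(3,0)<(3,1)<(0,−1)<(2,1)<(3,−1)`
on `[0,3] × [−1,1]` (recall `e : Fin 3` encodes `e−1 ∈ [−1,1]`). -/
def qeRank (q : Fin 4) (e : Fin 3) : ℕ :=
  match (q : ℕ), (e : ℕ) with
  | 0, 1 => 0
  | 1, 1 => 1
  | 0, 2 => 2
  | 1, 0 => 3
  | 2, 1 => 4
  | 1, 2 => 5
  | 2, 0 => 6
  | 3, 1 => 7
  | 3, 2 => 8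
  | 0, 0 => 9
  | 2, 2 => 10
  | _, _ => 11

/-- The rank of `(p,q,e)` in the total order on `Y`:
`(p',q',e') < (p,q,e)` iff `p' < p`, or `p' = p` and `(q',e') < (q,e)`. -/
def yRank (y : Yc) : ℕ := 12 * (y.1 : ℕ) + qeRank y.2.1 y.2.2

/-- The involution `μ(p,q,e) = ((p+e) mod 4, (q+e) mod 4, −e)` on `Y`. -/
def μY (y : Yc) : Yc :=
  if y.2.2 = 0 then (y.1 + 3, y.2.1 + 3, 2)
  else if y.2.2 = 2 then (y.1 + 1, y.2.1 + 1, 0)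
  else y

/-- The condition under which the midpoint of `(p',q',e') < (p,q,e)` is the
singleton `{(p,q,e)}`: `p' < p`, or `p' = p` and `(q',e') < (q,0)`, or
`p' = p`, `q' = q`, `e' = 0` and `e = 1`. -/
def singleCond (small big : Yc) : Prop :=
  (small.1 : ℕ) < big.1 ∨
  (small.1 = big.1 ∧ qeRank small.2.1 small.2.2 < qeRank big.2.1 1) ∨
  (small.1 = big.1 ∧ small.2.1 = big.2.1 ∧ small.2.2 = 1 ∧ big.2.2 = 2)

/-- The clause midpoints structure `m` on `Y`: for `(p',q',e') < (p,q,e)`,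
`m{(p',q',e'),(p,q,e)} = {(p,q,e)}` under `singleCond`, and otherwise
`= {(p,q,e), μ(p,q,e)}`. -/
noncomputable def mY (a b : Yc) : Set Yc :=
  let big := if yRank a ≤ yRank b then b else a
  let small := if yRank a ≤ yRank b then a else b
  if singleCond small big then {big} else {big, μY big}

/-- The attaching map `f` on the clause part: `f(x_{c,p,q,e}) ∈ X₀` as in the paper
(`f(x_{c,p,a,0}) = x_{ν(c,a),−σ(c,a)}` for `a ∈ [0,2]`, `f(x_{c,p,3,0}) = x_{0,1}`,
`f(x_{c,p,a,−1}) = f(x_{c,p,(a−1) mod 4,1}) = x_{ν(c,a),σ(c,a)}` for `a ∈ [0,2]`,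
and `f(x_{c,p,3,−1}) = f(x_{c,p,2,1}) = x_{V+1,1}`). -/
def fcl {V C : ℕ} (ν : Fin C → Fin 3 → Fin (V + 2)) (σ : Fin C → Fin 3 → Bool)
    (w : Fin C × Yc) : X₀ V :=
  let c := w.1
  let q := w.2.2.1
  let e := w.2.2.2
  if e = 1 then
    -- e encodes 0
    if h : (q : ℕ) < 3 then (ν c ⟨q, h⟩, ! σ c ⟨q, h⟩)
    else ((0 : Fin (V + 2)), true)
  else if e = 0 then
    -- e encodes −1
    if h : (q : ℕ) < 3 then (ν c ⟨q, h⟩, σ c ⟨q, h⟩)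
    else (Fin.last (V + 1), true)
  else
    -- e encodes +1
    if h : (q : ℕ) + 1 < 3 then (ν c ⟨(q : ℕ) + 1, h⟩, σ c ⟨(q : ℕ) + 1, h⟩)
    else if q = 3 then (ν c 0, σ c 0)
    else (Fin.last (V + 1), true)

/-- The extension of `f` to all of `X` (`f` is the identity on `X₀`). -/
def fP {V C : ℕ} (ν : Fin C → Fin 3 → Fin (V + 2)) (σ : Fin C → Fin 3 → Bool) :
    XP V C → X₀ V :=
  Sum.elim id (fcl ν σ)

/-- The midpoints structure `m_P` on `X`, obtained by combining `m₀` with a copy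
`m_c` of `m` for each clause `c` along `f` (`m_{≤0} = m₀`,
`m_{≤c} = m_{≤(c−1)} ∪_{f|_{X_c}} m_c`, `m_P = m_{≤C}`), written out explicitly:
for `x, x' ∈ X₀` the midpoint is `m₀{x,x'} ∪ f⁻¹(m₀{x,x'})`; for `x` in an earlier
part and `y ∈ X_c` it is `{y}`; and within one `X_c` it is the copy of `mY`. -/
noncomputable def mP (V C : ℕ) (ν : Fin C → Fin 3 → Fin (V + 2))
    (σ : Fin C → Fin 3 → Bool) : XP V C → XP V C → Set (XP V C) :=
  fun z w =>
    match z, w with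
    | Sum.inl a, Sum.inl b =>
        (Sum.inl '' m₀ a b) ∪ (Sum.inr '' {u : Fin C × Yc | fcl ν σ u ∈ m₀ a b})
    | Sum.inl _, Sum.inr y => {Sum.inr y}
    | Sum.inr y, Sum.inl _ => {Sum.inr y}
    | Sum.inr (c, y), Sum.inr (c', y') =>
        if c = c' then (fun u => (Sum.inr (c, u) : XP V C)) '' mY y y'
        else if c < c' then {Sum.inr (c', y')} else {Sum.inr (c, y)}

/-- `A_{v,s} = f⁻¹({x_{v,s}}) ⊆ X`. -/
def Avs {V C : ℕ} (ν : Fin C → Fin 3 → Fin (V + 2)) (σ : Fin C → Fin 3 → Bool)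
    (v : Fin (V + 2)) (s : Bool) : Set (XP V C) :=
  {z | fP ν σ z = (v, s)}

/-- `A_{>v} = f⁻¹({x_{v',s'} | v' > v}) ⊆ X`. -/
def Agt {V C : ℕ} (ν : Fin C → Fin 3 → Fin (V + 2)) (σ : Fin C → Fin 3 → Bool)
    (v : Fin (V + 2)) : Set (XP V C) :=
  {z | v < (fP ν σ z).1}

/-- `A_{<v} = f⁻¹({x_{v',s'} | v' < v}) ⊆ X`. -/
def Alt {V C : ℕ} (ν : Fin C → Fin 3 → Fin (V + 2)) (σ : Fin C → Fin 3 → Bool)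
    (v : Fin (V + 2)) : Set (XP V C) :=
  {z | (fP ν σ z).1 < v}

/-- `τ_{v,s} = t_{(A_{v,s},A_{v,−s})} − t_{(A_{v,−s},A_{>v})} + t_{(A_{>v},A_{<v})}
− t_{(A_{<v},A_{v,s})}`. -/
noncomputable def τP {V C : ℕ} (ν : Fin C → Fin 3 → Fin (V + 2))
    (σ : Fin C → Fin 3 → Bool) (t : Set (XP V C) → ℝ)
    (v : Fin (V + 2)) (s : Bool) : ℝ :=
  tW t (ioo (Avs ν σ v s) (Avs ν σ v (! s)))
  - tW t (ioo (Avs ν σ v (! s)) (Agt ν σ v))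
  + tW t (ioo (Agt ν σ v) (Alt ν σ v))
  - tW t (ioo (Alt ν σ v) (Avs ν σ v s))

section helpers

/-- Sum of `t` over the subsets satisfying `p`. -/
noncomputable def sP {X : Type*} [Fintype X] (t : Set X → ℝ) (p : Set X → Prop) : ℝ :=
  ∑ U : Set X, if p U then t U else 0

noncomputable def dT {X : Type*} [Fintype X] (t : Set X → ℝ) (a b : X) : ℝ :=
  sP t (fun U => a ∈ U ∧ b ∉ U)

variable {X : Type*} [Fintype X] {t : Set X → ℝ}

lemma tW_eq_sP (W : Set (Set X)) : tW t W = sP t (fun U => U ∈ W) := by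
  unfold tW sP
  rw [finsum_mem_def, finsum_eq_sum_of_fintype]
  refine Finset.sum_congr rfl fun U _ => ?_
  simp [Set.indicator_apply]

lemma sP_compl (h1 : ∀ S, t S = t Sᶜ) (p : Set X → Prop) :
    sP t (fun U => p Uᶜ) = sP t p := by
  unfold sP
  rw [← Equiv.sum_comp (Equiv.mk (fun U : Set X => Uᶜ) (fun U => Uᶜ)
    (fun U => compl_compl U) (fun U => compl_compl U)) (fun U => if p U then t U else 0)]
  refine Finset.sum_congr rfl fun U _ => ?_
  simp [← h1 U]

lemma sP_congr {p q : Set X → Prop} (h : ∀ U, t U ≠ 0 → (p U ↔ q U)) : sP t p = sP t q := by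
  unfold sP
  refine Finset.sum_congr rfl fun U _ => ?_
  by_cases h0 : t U = 0
  · simp [h0]
  · simp [h U h0]

lemma sP_or {p q : Set X → Prop} (h : ∀ U, p U → ¬ q U) :
    sP t (fun U => p U ∨ q U) = sP t p + sP t q := by
  unfold sP
  rw [← Finset.sum_add_distrib]
  refine Finset.sum_congr rfl fun U _ => ?_
  have := h U
  by_cases hp : p U <;> by_cases hq : q U <;> simp_all

lemma sP_mono (h0 : ∀ S, 0 ≤ t S) {p q : Set X → Prop} (h : ∀ U, t U ≠ 0 → p U → q U) :
    sP t p ≤ sP t q := by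
  unfold sP
  refine Finset.sum_le_sum fun U _ => ?_
  by_cases ht : t U = 0
  · simp [ht]
  have := h U ht
  by_cases hp : p U
  · simp [hp, this hp]
  · by_cases hq : q U <;> simp [hp, hq, h0 U]

lemma sP_single (T : Set X) : sP t (fun U => U = T) = t T := by
  unfold sP
  rw [Finset.sum_eq_single T] <;> simp +contextual

lemma dT_symm (h1 : ∀ S, t S = t Sᶜ) (a b : X) : dT t a b = dT t b a := by
  unfold dT
  rw [← sP_compl h1]
  exact sP_congr fun U _ => by simp [and_comm]

/-- Compatibility of a supported set with a positive edge. -/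
lemma compat (h2 : ∀ S T : Set X, (∀ e f : Bool, (sel S e ∩ sel T f).Nonempty) → t S * t T = 0)
    {A U : Set X} (hA : t A ≠ 0) (hU : t U ≠ 0) :
    U ⊆ A ∨ A ⊆ U ∨ Disjoint U A ∨ (∀ x, x ∈ U ∨ x ∈ A) := by
  by_contra hc
  push Not at hc
  obtain ⟨c1, c2, c3, c4⟩ := hc
  obtain ⟨x1, hx1, hx1'⟩ := Set.not_subset.1 c1
  obtain ⟨x2, hx2, hx2'⟩ := Set.not_subset.1 c2
  obtain ⟨x3, hx3, hx3'⟩ := Set.not_disjoint_iff.1 c3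
  obtain ⟨x4, hx4, hx4'⟩ := c4
  have := h2 U A (by
    intro e f
    cases e <;> cases f
    · exact ⟨x4, by simp [sel, hx4, hx4']⟩
    · exact ⟨x2, by simp [sel, hx2, hx2']⟩
    · exact ⟨x1, by simp [sel, hx1, hx1']⟩
    · exact ⟨x3, by simp [sel, hx3, hx3']⟩)
  rcases mul_eq_zero.1 this with h | h <;> contradiction

lemma tW_icc_mem (h1 : ∀ S, t S = t Sᶜ) {T : Set X} {x x' : X} (hx : x ∉ T) (hx' : x' ∈ T) :
    tW t (icc {x'} T) = 2 * sP t (fun U => x' ∈ U ∧ U ⊆ T) := by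
  rw [tW_eq_sP]
  have e : sP t (fun U => U ∈ icc {x'} T) =
      sP t (fun U => (x' ∈ U ∧ U ⊆ T) ∨ (x' ∈ Uᶜ ∧ Uᶜ ⊆ T)) := by
    refine sP_congr fun U _ => ?_
    have hne : x ≠ x' := fun h => hx (h ▸ hx')
    constructor
    · rintro ⟨e, f, g, ha, hb⟩
      have hab := ha.trans hb
      cases e <;> cases f <;> simp [sel] at ha hb hab
      · have hT : T = {x'} := by
          ext y; simp only [Set.mem_singleton_iff]
          constructor
          · intro hy; exact hab y hy
          · rintro rfl; exact hx'
        subst hT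
        cases g <;> simp at ha hb
        · left; grind
        · right; grind
      · exact absurd (hab (by simpa using hne)) hx
      · exact absurd hx' hab
      · cases g <;> simp at ha hb
        · right; exact ⟨ha, hb⟩
        · left; exact ⟨ha, hb⟩
    · rintro (⟨a, b⟩ | ⟨a, b⟩)
      · exact ⟨true, true, true, by simpa [sel] using a, by simpa [sel] using b⟩
      · exact ⟨true, true, false, by simpa [sel] using a, by simpa [sel] using b⟩
  rw [e, sP_or, sP_compl h1 (fun U => x' ∈ U ∧ U ⊆ T)]
  · ring
  · rintro U ⟨a, b⟩ ⟨c, d⟩; exact c a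

lemma icc_compl (S T : Set X) : icc S Tᶜ = icc S T := by
  ext U
  constructor
  · rintro ⟨e, f, g, ha, hb⟩
    refine ⟨e, !f, g, ha, ?_⟩
    cases f <;> simpa [sel] using hb
  · rintro ⟨e, f, g, ha, hb⟩
    refine ⟨e, !f, g, ha, ?_⟩
    cases f <;> simpa [sel] using hb

lemma tW_icc_ico {S T : Set X} (hT : T ∈ icc S T) :
    tW t (icc S T) = tW t (ico S T) + t T := by
  rw [tW_eq_sP, tW_eq_sP, ← sP_single (t := t) T, ← sP_or]
  · refine sP_congr fun U _ => ?_
    simp only [ico, Set.mem_diff, Set.mem_singleton_iff]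
    by_cases h : U = T
    · subst h; simp [hT]
    · simp [h]
  · rintro U ⟨_, h⟩ h'; exact h h'

/-- Core comparison. -/
lemma core (h1 : ∀ S, t S = t Sᶜ) (h0 : ∀ S, 0 ≤ t S)
    (h2 : ∀ S T : Set X, (∀ e f : Bool, (sel S e ∩ sel T f).Nonempty) → t S * t T = 0)
    {T : Set X} {x x' z : X} (hx : x ∉ T) (hx' : x' ∈ T) (hz : z ∉ T) (hT : t T ≠ 0)
    (h : tW t (icc {x} T) - t T < tW t (icc {x'} T)) : dT t x z < dT t x' z := by
  rw [tW_icc_mem h1 hx hx', ← icc_compl, tW_icc_mem h1 (T := Tᶜ) (x := x') (x' := x)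
    (by simpa using hx') hx] at h
  have e1 : sP t (fun U => x ∈ U ∧ U ⊆ Tᶜ) = sP t (fun U => (x ∈ U ∧ U ⊂ Tᶜ) ∨ U = Tᶜ) := by
    refine sP_congr fun U _ => ?_
    constructor
    · rintro ⟨a, b⟩
      rcases b.eq_or_ssubset with h | h
      · exact Or.inr h
      · exact Or.inl ⟨a, h⟩
    · rintro (⟨a, b⟩ | rfl)
      · exact ⟨a, b.subset⟩
      · exact ⟨hx, subset_rfl⟩
  rw [e1, sP_or (fun U hU hU' => hU.2.ne hU'), sP_single, ← h1] at h
  have hT0 := h0 T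
  -- decompose
  have d1 : dT t x z = sP t (fun U => (x ∈ U ∧ x' ∈ U ∧ z ∉ U) ∨ (x ∈ U ∧ x' ∉ U ∧ z ∉ U)) :=
    sP_congr fun U _ => by by_cases x' ∈ U <;> simp [*]
  have d2 : dT t x' z = sP t (fun U => (x ∈ U ∧ x' ∈ U ∧ z ∉ U) ∨ (x ∉ U ∧ x' ∈ U ∧ z ∉ U)) :=
    sP_congr fun U _ => by by_cases x ∈ U <;> simp [*]
  rw [sP_or (by grind)] at d1 d2
  have i1 : sP t (fun U => x ∈ U ∧ x' ∉ U ∧ z ∉ U) ≤ sP t (fun U => x ∈ U ∧ U ⊂ Tᶜ) := by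
    refine sP_mono h0 fun U hU ⟨a, b, c⟩ => ⟨a, ?_⟩
    rcases compat h2 hT hU with k | k | k | k
    · exact absurd (k a) hx
    · exact absurd (k hx') b
    · refine ⟨fun y hy hy' => Set.disjoint_left.1 k hy hy', fun k' => c (k' hz)⟩
    · rcases k z with k | k <;> contradiction
  have i2 : sP t (fun U => x' ∈ U ∧ U ⊆ T) ≤ sP t (fun U => x ∉ U ∧ x' ∈ U ∧ z ∉ U) :=
    sP_mono h0 fun U hU ⟨a, b⟩ => ⟨fun k => hx (b k), a, fun k => hz (b k)⟩
  linarith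

lemma edge_pos {T : Set X} {x x' : X} (hx : x ∉ T) (hx' : x' ∈ T)
    (ha : tW t (ico {x'} T) < tW t (icc {x} T)) (hb : tW t (ico {x} T) < tW t (icc {x'} T)) :
    0 < t T := by
  have k1 : tW t (icc {x} T) = _ :=
    tW_icc_ico ⟨true, false, false, by simpa [sel] using hx, by simp [sel]⟩
  have k2 : tW t (icc {x'} T) = _ :=
    tW_icc_ico ⟨true, true, true, by simpa [sel] using hx', by simp [sel]⟩
  linarith

lemma core2 (h1 : ∀ S, t S = t Sᶜ) (h0 : ∀ S, 0 ≤ t S)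
    (h2 : ∀ S T : Set X, (∀ e f : Bool, (sel S e ∩ sel T f).Nonempty) → t S * t T = 0)
    {T : Set X} {x x' : X} (hx : x ∉ T) (hx' : x' ∈ T)
    (ha : tW t (ico {x'} T) < tW t (icc {x} T)) (hb : tW t (ico {x} T) < tW t (icc {x'} T))
    (z : X) : (z ∉ T → dT t x z < dT t x' z) ∧ (z ∈ T → dT t x' z < dT t x z) := by
  have hT := (edge_pos hx hx' ha hb).ne'
  have k1 : tW t (icc {x} T) = _ :=
    tW_icc_ico ⟨true, false, false, by simpa [sel] using hx, by simp [sel]⟩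
  have k2 : tW t (icc {x'} T) = _ :=
    tW_icc_ico ⟨true, true, true, by simpa [sel] using hx', by simp [sel]⟩
  constructor
  · intro hz
    exact core h1 h0 h2 hx hx' hz hT (by linarith)
  · intro hz
    refine core h1 h0 h2 (T := Tᶜ) (by simpa using hx') hx (by simpa using hz) (by rwa [← h1]) ?_
    rw [icc_compl, icc_compl, ← h1]
    linarith

lemma dT_edge (h2 : ∀ S T : Set X, (∀ e f : Bool, (sel S e ∩ sel T f).Nonempty) → t S * t T = 0)
    {A : Set X} (hA : t A ≠ 0) {a x : X} (ha : a ∈ A) (hx : x ∉ A) :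
    dT t a x = sP t (fun U => a ∈ U ∧ U ⊆ A) + sP t (fun U => A ⊂ U ∧ x ∉ U) := by
  rw [← sP_or (fun U hU hU' => hU'.1.2 hU.2)]
  refine sP_congr fun U hU => ?_
  constructor
  · rintro ⟨b, c⟩
    rcases compat h2 hA hU with k | k | k | k
    · exact Or.inl ⟨b, k⟩
    · by_cases k' : U ⊆ A
      · exact Or.inl ⟨b, k'⟩
      · exact Or.inr ⟨⟨k, k'⟩, c⟩
    · exact absurd ha (Set.disjoint_left.1 k b)
    · rcases k x with k | k <;> contradiction
  · rintro (⟨b, c⟩ | ⟨b, c⟩)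
    · exact ⟨b, fun k => hx (c k)⟩
    · exact ⟨b.subset ha, c⟩

lemma dT_edge2 (h1 : ∀ S, t S = t Sᶜ)
    (h2 : ∀ S T : Set X, (∀ e f : Bool, (sel S e ∩ sel T f).Nonempty) → t S * t T = 0)
    {A B : Set X} (hA : t A ≠ 0) (hB : t B ≠ 0) {a b w : X} (ha : a ∈ A) (hb : b ∈ B)
    (hAB : ∀ x, x ∈ A → x ∉ B) (hwA : w ∉ A) (hwB : w ∉ B) :
    dT t a b = sP t (fun U => a ∈ U ∧ U ⊆ A) + sP t (fun U => b ∈ U ∧ U ⊆ B) +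
      tW t (ioo A B) / 2 := by
  rw [dT_edge h2 hA ha (fun h => hAB b h hb)]
  have e1 : sP t (fun U => A ⊂ U ∧ b ∉ U) =
      sP t (fun U => (b ∈ Uᶜ ∧ Uᶜ ⊆ B) ∨ (A ⊂ U ∧ B ⊂ Uᶜ)) := by
    refine sP_congr fun U hU => ?_
    constructor
    · rintro ⟨p, q⟩
      rcases compat h2 hB (U := Uᶜ) (by rwa [← h1]) with k | k | k | k
      · exact Or.inl ⟨q, k⟩
      · by_cases k' : Uᶜ ⊆ B
        · exact Or.inl ⟨q, k'⟩
        · exact Or.inr ⟨p, ⟨k, k'⟩⟩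
      · exact absurd hb (Set.disjoint_left.1 k q)
      · rcases k a with k | k
        · exact absurd (p.subset ha) k
        · exact absurd k (hAB a ha)
    · rintro (⟨p, q⟩ | ⟨p, q⟩)
      · refine ⟨⟨fun x hx => ?_, fun h => ?_⟩, p⟩
        · by_contra hc; exact hAB x hx (q hc)
        · exact hwB (q (fun hw => hwA (h hw)))
      · exact ⟨p, q.subset hb⟩
  rw [e1, sP_or (fun U hU hU' => hU'.2.2 hU.2), sP_compl h1 (fun U => b ∈ U ∧ U ⊆ B)]
  have e2 : tW t (ioo A B) = sP t (fun U => (A ⊂ U ∧ B ⊂ Uᶜ) ∨ (A ⊂ Uᶜ ∧ B ⊂ Uᶜᶜ)) := by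
    rw [tW_eq_sP]
    refine sP_congr fun U _ => ?_
    have aB := hAB a ha
    have bA : b ∉ A := fun h => hAB b h hb
    constructor
    · rintro ⟨⟨e, f, g, p, q⟩, r⟩
      simp only [Set.mem_insert_iff, Set.mem_singleton_iff, not_or] at r
      obtain ⟨r1, r2, r3, r4⟩ := r
      have pq := p.trans q
      cases e <;> cases f <;> simp [sel] at p q pq
      · exact absurd (pq hb) bA
      · exact absurd (pq hwA) hwB
      · cases g <;> simp at p q
        · right
          exact ⟨HasSubset.Subset.ssubset_of_ne p (fun h => r2 (by rw [h, compl_compl])),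
            by rw [compl_compl]; exact HasSubset.Subset.ssubset_of_ne q (Ne.symm r3)⟩
        · left
          refine ⟨HasSubset.Subset.ssubset_of_ne p (Ne.symm r1), 
            HasSubset.Subset.ssubset_of_ne (fun x hx hxU => q hxU hx) (fun h => r4 (by rw [h, compl_compl]))⟩
      · exact absurd (pq ha) aB
    · have key : ∀ W : Set X, A ⊂ W → B ⊂ Wᶜ → W ≠ A ∧ W ≠ Aᶜ ∧ W ≠ B ∧ W ≠ Bᶜ := by
        intro W p q
        refine ⟨p.ne', fun h => ?_, fun h => ?_, fun h => ?_⟩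
        · have := p.subset ha; rw [h] at this; exact this ha
        · have := p.subset ha; rw [h] at this; exact aB this
        · rw [h, compl_compl] at q; exact q.ne rfl
      rintro (⟨p, q⟩ | ⟨p, q⟩)
      · refine ⟨⟨true, false, true, by simpa [sel] using p.subset, ?_⟩, ?_⟩
        · simp only [sel]; intro x hx hxB; exact q.subset hxB hx
        · have := key U p q; simp [this]
      · refine ⟨⟨true, false, false, by simpa [sel] using p.subset, ?_⟩, ?_⟩
        · simp only [sel]; intro x hx hxB; exact q.subset hxB hx
        · obtain ⟨k1, k2, k3, k4⟩ := key _ p q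
          simp only [Set.mem_insert_iff, Set.mem_singleton_iff, not_or]
          exact ⟨fun h => k2 (by rw [h]), fun h => k1 (by rw [h, compl_compl]),
            fun h => k4 (by rw [h]), fun h => k3 (by rw [h, compl_compl])⟩
  rw [e2, sP_or, sP_compl h1 (fun U => A ⊂ U ∧ B ⊂ Uᶜ)]
  · ring
  · rintro U ⟨p, _⟩ ⟨q, _⟩
    exact q.subset ha (p.subset ha)

end helpers

section clause

variable {V C : ℕ} {ν : Fin C → Fin 3 → Fin (V + 2)} {σ : Fin C → Fin 3 → Bool}
  {t : Set (XP V C) → ℝ}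

lemma mY_lt {y y' : Yc} (h : yRank y < yRank y') :
    mY y y' = (if singleCond y y' then {y'} else {y', μY y'}) ∧
    mY y' y = (if singleCond y y' then {y'} else {y', μY y'}) := by
  constructor
  · simp only [mY, if_pos h.le]
  · simp only [mY, if_neg (not_le.2 h)]

lemma yfacts (ht : IsTreeRealization (mP V C ν σ) t) (c : Fin C) {y y' : Yc}
    (h : yRank y < yRank y') (hμ : y ≠ μY y') (z : XP V C) :
    let T : Set (XP V C) := (fun u => (Sum.inr (c, u) : XP V C)) ''
      (if singleCond y y' then {y'} else {y', μY y'})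
    (z ∉ T → dT t (Sum.inr (c, y)) z < dT t (Sum.inr (c, y')) z) ∧
    (z ∈ T → dT t (Sum.inr (c, y')) z < dT t (Sum.inr (c, y)) z) := by
  intro T
  have hne : y ≠ y' := fun k => by subst k; exact lt_irrefl _ h
  obtain ⟨hh, h2, h3⟩ := ht
  have e1 : mP V C ν σ (Sum.inr (c, y)) (Sum.inr (c, y')) = T := by
    simp only [mP, if_true, (mY_lt h).1]; rfl
  have e2 : mP V C ν σ (Sum.inr (c, y')) (Sum.inr (c, y)) = T := by
    simp only [mP, if_true, (mY_lt h).2]; rfl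
  have a := h3 (Sum.inr (c, y)) (Sum.inr (c, y')) (by simpa using hne)
  have b := h3 (Sum.inr (c, y')) (Sum.inr (c, y)) (by simpa using hne.symm)
  rw [e1] at a
  rw [e2] at b
  refine core2 (fun S => (hh S).1) (fun S => (hh S).2) h2 ?_ ?_ a b z
  · simp only [T]; split_ifs <;> simp [hne, hμ]
  · simp only [T]; split_ifs <;> simp

lemma K1 (ht : IsTreeRealization (mP V C ν σ) t) (c : Fin C) {y y' u : Yc}
    (h : yRank y < yRank y' ∧ y ≠ μY y' ∧ singleCond y y' ∧ u ≠ y') :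
    dT t (Sum.inr (c, y)) (Sum.inr (c, u)) < dT t (Sum.inr (c, y')) (Sum.inr (c, u)) := by
  refine (yfacts ht c h.1 h.2.1 _).1 ?_
  simp [h.2.2.1, h.2.2.2]

lemma K2 (ht : IsTreeRealization (mP V C ν σ) t) (c : Fin C) {y y' : Yc}
    (h : yRank y < yRank y' ∧ y ≠ μY y' ∧ ¬ singleCond y y') (w : X₀ V) :
    dT t (Sum.inr (c, y)) (Sum.inl w) < dT t (Sum.inr (c, y')) (Sum.inl w) := by
  refine (yfacts ht c h.1 h.2.1 _).1 ?_
  simp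

lemma K3 (ht : IsTreeRealization (mP V C ν σ) t) (c : Fin C) {y y' u : Yc}
    (h : yRank y < yRank y' ∧ y ≠ μY y' ∧ ¬ singleCond y y' ∧ u = μY y') :
    dT t (Sum.inr (c, y')) (Sum.inr (c, u)) < dT t (Sum.inr (c, y)) (Sum.inr (c, u)) := by
  refine (yfacts ht c h.1 h.2.1 _).2 ?_
  simp [h.2.2.1, h.2.2.2]

lemma mP_inl (a b : X₀ V) : mP V C ν σ (Sum.inl a) (Sum.inl b) = {z | fP ν σ z ∈ m₀ a b} := by
  ext z
  rcases z with z | z <;> simp [mP, fP]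

lemma edge_X0 (ht : IsTreeRealization (mP V C ν σ) t) {a b : X₀ V} {T : Set (X₀ V)}
    (e1 : m₀ a b = T) (e2 : m₀ b a = T) (ha : a ∉ T) (hb : b ∈ T) :
    t {z | fP ν σ z ∈ T} ≠ 0 := by
  have hne : a ≠ b := fun h => ha (h ▸ hb)
  obtain ⟨hh, h2, h3⟩ := ht
  have p := h3 (Sum.inl a) (Sum.inl b) (by simpa using hne)
  have q := h3 (Sum.inl b) (Sum.inl a) (by simpa using hne.symm)
  rw [mP_inl, e1] at p
  rw [mP_inl, e2] at q
  exact (edge_pos (by simpa [fP] using ha) (by simpa [fP] using hb) p q).ne'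

lemma edge_A (ht : IsTreeRealization (mP V C ν σ) t) {v : Fin (V + 2)} {s : Bool}
    (h : (v, s) ≠ (0, false)) : t (Avs ν σ v s) ≠ 0 := by
  have hv : ¬ ((v : ℕ) = 0 ∧ s = false) := by
    rintro ⟨h1, h2⟩; exact h (by rw [h2]; congr 1; exact Fin.ext h1)
  have hk : 0 < key (v, s) := by
    unfold key; cases s
    · have : (v : ℕ) ≠ 0 := fun h => hv ⟨h, rfl⟩
      simp only; omega
    · simp
  have hk0 : key ((0, false) : X₀ V) = 0 := by simp [key]
  have := edge_X0 (C := C) ht (a := (0, false)) (b := (v, s)) (T := {(v, s)}) ?_ ?_ ?_ ?_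
  · simpa [Avs] using this
  · simp only [m₀, hk0, Nat.zero_le, if_true]
    rw [if_neg]
    rintro ⟨h', -⟩
    cases s
    · have : (v : ℕ) ≠ 0 := fun h => hv ⟨h, rfl⟩
      simp [sgn] at h'
      exact hv ⟨by simp [h'], rfl⟩
    · simp [sgn] at h'
      omega
  · simp only [m₀, hk0, if_neg (not_le.2 hk)]
    rw [if_neg]
    rintro ⟨h', -⟩
    cases s
    · have : (v : ℕ) ≠ 0 := fun h => hv ⟨h, rfl⟩
      simp [sgn] at h'
      exact hv ⟨by simp [h'], rfl⟩
    · simp [sgn] at h'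
      omega
  · simpa using h.symm
  · simp

lemma edge_ge (ht : IsTreeRealization (mP V C ν σ) t) {u v : Fin (V + 2)}
    (h : (u : ℕ) + 1 = v) : t {z | v ≤ (fP ν σ z).1} ≠ 0 := by
  have huv : u < v := by rw [Fin.lt_def]; omega
  have hk : key (u, true) < key (v, false) := by simp [key]; omega
  have hc : 2 * ((u : ℕ) : ℤ) + sgn true = 2 * ((v : ℕ) : ℤ) + sgn false ∧ u < v := by
    refine ⟨?_, huv⟩
    simp [sgn]; omega
  have := edge_X0 (C := C) ht (a := (u, true)) (b := (v, false)) (T := {x | v ≤ x.1}) ?_ ?_ ?_ ?_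
  · simpa using this
  · simp only [m₀, if_pos hk.le]
    rw [if_pos hc]
  · simp only [m₀, if_neg (not_le.2 hk)]
    rw [if_pos hc]
  · simpa using huv
  · simp

/-- `τ` as a four-point alternating sum of distances. -/
lemma tau_eq (ht : IsTreeRealization (mP V C ν σ) t) {v : Fin (V + 2)} (s : Bool)
    (hv : 1 ≤ (v : ℕ) ∧ (v : ℕ) ≤ V) {g l : X₀ V} (hg : v < g.1) (hl : l.1 < v) :
    τP ν σ t v s = 2 * (dT t (Sum.inl (v, s)) (Sum.inl (v, !s)) - dT t (Sum.inl (v, !s)) (Sum.inl g)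
      + dT t (Sum.inl g) (Sum.inl l) - dT t (Sum.inl l) (Sum.inl (v, s))) := by
  have hv0 : ∀ s, (v, s) ≠ ((0 : Fin (V + 2)), false) := by
    intro s h
    have : v = 0 := congrArg Prod.fst h
    rw [this] at hv; simp at hv
  have A1 := edge_A (C := C) ht (hv0 s)
  have A2 := edge_A (C := C) ht (hv0 (!s))
  have A3 : t (Agt ν σ v) ≠ 0 := by
    have := edge_ge (C := C) ht (u := v) (v := ⟨v + 1, by omega⟩) rfl
    convert this using 2
    ext z; simp only [Agt, Set.mem_ofPred_eq, Fin.lt_def, Fin.le_def]; omega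
  have A4 : t (Alt ν σ v) ≠ 0 := by
    have := edge_ge (C := C) ht (u := ⟨v - 1, by omega⟩) (v := v) (by simp; omega)
    rw [(ht.1 _).1] at this
    convert this using 2
    ext z; simp [Alt]
  have h1 := fun S => (ht.1 S).1
  have m1 : (Sum.inl (v, s) : XP V C) ∈ Avs ν σ v s := by simp [Avs, fP]
  have m2 : (Sum.inl (v, !s) : XP V C) ∈ Avs ν σ v (!s) := by simp [Avs, fP]
  have m3 : (Sum.inl g : XP V C) ∈ Agt ν σ v := by simpa [Agt, fP] using hg
  have m4 : (Sum.inl l : XP V C) ∈ Alt ν σ v := by simpa [Alt, fP] using hl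
  have d12 : ∀ x : XP V C, x ∈ Avs ν σ v s → x ∉ Avs ν σ v (!s) := by
    intro x hx hy
    have : (v, s) = (v, !s) := by rw [← (show fP ν σ x = _ from hx)]; exact hy
    simp at this
  have d13 : ∀ s, ∀ x : XP V C, x ∈ Avs ν σ v s → x ∉ Agt ν σ v := by
    intro s x hx hy
    simp only [Avs, Agt, Set.mem_ofPred_eq] at hx hy
    rw [hx] at hy; exact lt_irrefl _ hy
  have d14 : ∀ s, ∀ x : XP V C, x ∈ Avs ν σ v s → x ∉ Alt ν σ v := by
    intro s x hx hy
    simp only [Avs, Alt, Set.mem_ofPred_eq] at hx hy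
    rw [hx] at hy; exact lt_irrefl _ hy
  have d34 : ∀ x : XP V C, x ∈ Agt ν σ v → x ∉ Alt ν σ v := by
    intro x hx hy
    simp only [Agt, Alt, Set.mem_ofPred_eq] at hx hy
    exact lt_asymm hx hy
  have e1 := dT_edge2 h1 ht.2.1 A1 A2 m1 m2 d12 (fun k => d13 s _ k m3) (fun k => d13 _ _ k m3)
  have e2 := dT_edge2 h1 ht.2.1 A2 A3 m2 m3 (d13 _) (w := Sum.inl l)
    (fun k => d14 _ _ k m4) (fun k => d34 _ k m4)
  have e3 := dT_edge2 h1 ht.2.1 A3 A4 m3 m4 d34 (d13 _ _ m1) (d14 _ _ m1)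
  have e4 := dT_edge2 h1 ht.2.1 A4 A1 m4 m1 (fun x hx hy => d14 _ _ hy hx) (w := Sum.inl g)
    (d34 _ m3) (fun k => d13 _ _ k m3)
  unfold τP
  linarith

noncomputable def gg (ν : Fin C → Fin 3 → Fin (V + 2)) (σ : Fin C → Fin 3 → Bool)
    (t : Set (XP V C) → ℝ) (u : XP V C) : ℝ :=
  dT t u (Sum.inl (0, false)) - dT t (Sum.inl (fP ν σ u)) (Sum.inl (0, false))

lemma dT_class (ht : IsTreeRealization (mP V C ν σ) t) {u w : XP V C} {a b : X₀ V}
    (hu : fP ν σ u = a) (hw : fP ν σ w = b) (hab : a ≠ b)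
    (ha : a ≠ (0, false)) (hb : b ≠ (0, false)) :
    dT t u w = gg ν σ t u + gg ν σ t w + dT t (Sum.inl a) (Sum.inl b) := by
  have h1 := fun S => (ht.1 S).1
  obtain ⟨va, sa⟩ := a
  obtain ⟨vb, sb⟩ := b
  have A := edge_A (C := C) ht ha
  have B := edge_A (C := C) ht hb
  have ma : (Sum.inl (va, sa) : XP V C) ∈ Avs ν σ va sa := by simp [Avs, fP]
  have mb : (Sum.inl (vb, sb) : XP V C) ∈ Avs ν σ vb sb := by simp [Avs, fP]
  have mu : u ∈ Avs ν σ va sa := hu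
  have mw : w ∈ Avs ν σ vb sb := hw
  have nu : u ∉ Avs ν σ vb sb := fun h => hab (hu.symm.trans h)
  have nb : (Sum.inl (vb, sb) : XP V C) ∉ Avs ν σ va sa := fun h => hab (Eq.symm h)
  have za : (Sum.inl (0, false) : XP V C) ∉ Avs ν σ va sa := fun h => ha (Eq.symm h)
  have zb : (Sum.inl (0, false) : XP V C) ∉ Avs ν σ vb sb := fun h => hb (Eq.symm h)
  have e1 := dT_edge ht.2.1 B mw nu
  have e2 := dT_edge ht.2.1 B mb nu
  have e3 := dT_edge ht.2.1 B mw zb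
  have e4 := dT_edge ht.2.1 B mb zb
  have e5 := dT_edge ht.2.1 A mu nb
  have e6 := dT_edge ht.2.1 A ma nb
  have e7 := dT_edge ht.2.1 A mu za
  have e8 := dT_edge ht.2.1 A ma za
  have s1 := dT_symm h1 u w
  have s2 := dT_symm h1 u (Sum.inl (vb, sb))
  unfold gg
  rw [hu, hw]
  linarith

end clause
theorem exists_tau_pos (V C : ℕ) (ν : Fin C → Fin 3 → Fin (V + 2))
    (σ : Fin C → Fin 3 → Bool)
    (hrange : ∀ c a, 1 ≤ (ν c a : ℕ) ∧ (ν c a : ℕ) ≤ V)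
    (hmono : ∀ c, (ν c 0 : ℕ) < (ν c 1 : ℕ) ∧ (ν c 1 : ℕ) < (ν c 2 : ℕ))
    (t : Set (XP V C) → ℝ) (ht : IsTreeRealization (mP V C ν σ) t) :
    ∀ c : Fin C, ∃ a : Fin 3, 0 < τP ν σ t (ν c a) (σ c a) := by
  intro c
  have h1 := fun S => (ht.1 S).1
  let x : Fin 4 → Fin 4 → XP V C := fun p q => Sum.inr (c, (p, q, 1))
  let a : Fin 4 → Fin 4 → XP V C := fun p q => Sum.inr (c, (p, q, 0))
  let b : Fin 4 → Fin 4 → XP V C := fun p q => Sum.inr (c, (p, q, 2))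
  let z : XP V C := Sum.inl (0, false)
  -- inequalities
  have i0 : ∀ p, dT t (x p 0) (a (p+1) 1) < dT t (x p 1) (a (p+1) 1) := fun p =>
    (K1 ht c (y := (p, 0, 1)) (y' := (p, 0, 2)) (u := (p+1, 1, 0))
      (by unfold singleCond; revert p; decide)).trans
    (K3 ht c (y := (p, 1, 1)) (y' := (p, 0, 2)) (u := (p+1, 1, 0))
      (by unfold singleCond; revert p; decide))
  have i1 : ∀ p, dT t (x p 1) (a (p+1) 2) < dT t (x p 2) (a (p+1) 2) := fun p =>
    (K1 ht c (y := (p, 1, 1)) (y' := (p, 1, 2)) (u := (p+1, 2, 0))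
      (by unfold singleCond; revert p; decide)).trans
    (K3 ht c (y := (p, 2, 1)) (y' := (p, 1, 2)) (u := (p+1, 2, 0))
      (by unfold singleCond; revert p; decide))
  have i2 : ∀ p, dT t (x p 2) (a (p+1) 3) < dT t (x p 3) (a (p+1) 3) := fun p =>
    (K1 ht c (y := (p, 2, 1)) (y' := (p, 2, 2)) (u := (p+1, 3, 0))
      (by unfold singleCond; revert p; decide)).trans
    (K3 ht c (y := (p, 3, 1)) (y' := (p, 2, 2)) (u := (p+1, 3, 0))
      (by unfold singleCond; revert p; decide))
  have i3 : ∀ p, dT t (x p 3) (a (p+1) 0) < dT t (b p 3) (a (p+1) 0) := fun p =>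
    K1 ht c (y := (p, 3, 1)) (y' := (p, 3, 2)) (u := (p+1, 0, 0))
      (by unfold singleCond; revert p; decide)
  have i4 : ∀ p, dT t (b p 3) z < dT t (a p 0) z := fun p =>
    K2 ht c (y := (p, 3, 2)) (y' := (p, 0, 0)) (by unfold singleCond; revert p; decide) _
  have i5 : ∀ p, dT t (a p 0) (b (p+3) 3) < dT t (x p 0) (b (p+3) 3) := fun p =>
    K3 ht c (y := (p, 0, 1)) (y' := (p, 0, 0)) (u := (p+3, 3, 2))
      (by unfold singleCond; revert p; decide)
  -- classes
  have ne0 : ∀ (i : Fin 3) (s : Bool), (ν c i, s) ≠ ((0 : Fin (V + 2)), false) := by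
    intro i s h
    have h' : ν c i = 0 := congrArg Prod.fst h
    have := hrange c i
    rw [h'] at this; simp at this
  have fx : ∀ p, fP ν σ (x p 0) = (ν c 0, !σ c 0) ∧ fP ν σ (x p 1) = (ν c 1, !σ c 1) ∧
      fP ν σ (x p 2) = (ν c 2, !σ c 2) ∧ fP ν σ (x p 3) = (0, true) := fun p =>
    ⟨rfl, rfl, rfl, rfl⟩
  have fa : ∀ p, fP ν σ (a p 0) = (ν c 0, σ c 0) ∧ fP ν σ (a p 1) = (ν c 1, σ c 1) ∧
      fP ν σ (a p 2) = (ν c 2, σ c 2) ∧ fP ν σ (a p 3) = (Fin.last (V+1), true) := fun p =>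
    ⟨rfl, rfl, rfl, rfl⟩
  have fb : ∀ p, fP ν σ (b p 3) = (ν c 0, σ c 0) := fun p => rfl
  have n01 : ν c 0 < ν c 1 := (hmono c).1
  have n12 : ν c 1 < ν c 2 := (hmono c).2
  have n0 : ∀ i, (0 : Fin (V+2)) < ν c i := fun i => by
    rw [Fin.lt_def]; exact (hrange c i).1
  have nL : ∀ i, ν c i < Fin.last (V+1) := fun i => by
    rw [Fin.lt_def]; have := (hrange c i).2; simp; omega
  have l0 : ((0 : Fin (V+2)), true) ≠ (0, false) := by simp
  have lL : (Fin.last (V+1), true) ≠ ((0 : Fin (V+2)), false) := by simp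
  have ns : ∀ i, (ν c i, !σ c i) ≠ (ν c i, σ c i) := by simp
  have fn : ∀ {u v : Fin (V+2)} {r s : Bool}, u < v → (u, r) ≠ (v, s) := fun h k =>
    h.ne (congrArg Prod.fst k)
  have c0 := fun p => dT_class ht (fx p).1 (fa (p+1)).2.1 (fn n01) (ne0 _ _) (ne0 _ _)
  have c0' := fun p => dT_class ht (fx p).2.1 (fa (p+1)).2.1 (ns 1) (ne0 _ _) (ne0 _ _)
  have c1 := fun p => dT_class ht (fx p).2.1 (fa (p+1)).2.2.1 (fn n12) (ne0 _ _) (ne0 _ _)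
  have c1' := fun p => dT_class ht (fx p).2.2.1 (fa (p+1)).2.2.1 (ns 2) (ne0 _ _) (ne0 _ _)
  have c2 := fun p => dT_class ht (fx p).2.2.1 (fa (p+1)).2.2.2 (fn (nL 2)) (ne0 _ _) lL
  have c2' := fun p => dT_class ht (fx p).2.2.2 (fa (p+1)).2.2.2
    (fn ((n0 2).trans (nL 2))) l0 lL
  have c3 := fun p => dT_class ht (fx p).2.2.2 (fa (p+1)).1 (fn (n0 0)) l0 (ne0 _ _)
  have c5 := fun p => dT_class ht (fx p).1 (fb (p+3)) (ns 0) (ne0 _ _) (ne0 _ _)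
  have ga : ∀ p, gg ν σ t (a p 0) = dT t (a p 0) z - dT t (Sum.inl (ν c 0, σ c 0)) z := fun p => by
    rw [gg, (fa p).1]
  have gb : ∀ p, gg ν σ t (b p 3) = dT t (b p 3) z - dT t (Sum.inl (ν c 0, σ c 0)) z := fun p => by
    rw [gg, fb p]
  have s5 := fun p => dT_symm h1 (a p 0) (b (p+3) 3)
  have T0 := tau_eq ht (σ c 0) (hrange c 0) (g := (ν c 1, σ c 1)) (l := (0, true)) n01 (n0 0)
  have T1 := tau_eq ht (σ c 1) (hrange c 1) (g := (ν c 2, σ c 2)) (l := (0, true)) n12 (n0 1)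
  have T2 := tau_eq ht (σ c 2) (hrange c 2) (g := (Fin.last (V+1), true)) (l := (0, true))
    (nL 2) (n0 2)
  have S := fun i => dT_symm h1 (Sum.inl (ν c i, σ c i)) (Sum.inl (ν c i, !σ c i))
  have S1 := fun i => dT_symm h1 (Sum.inl (ν c i, σ c i)) (Sum.inl (0, true))
  have S3 := dT_symm h1 (Sum.inl (Fin.last (V+1), true)) (Sum.inl (0, true))
  by_contra hc
  push Not at hc
  have hc0 := hc 0
  have hc1 := hc 1
  have hc2 := hc 2
  have j0 : ∀ p, gg ν σ t (x p 0) + dT t (Sum.inl (ν c 0, !σ c 0)) (Sum.inl (ν c 1, σ c 1)) <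
      gg ν σ t (x p 1) + dT t (Sum.inl (ν c 1, !σ c 1)) (Sum.inl (ν c 1, σ c 1)) := fun p => by
    have := i0 p; rw [c0, c0'] at this; linarith
  have j1 : ∀ p, gg ν σ t (x p 1) + dT t (Sum.inl (ν c 1, !σ c 1)) (Sum.inl (ν c 2, σ c 2)) <
      gg ν σ t (x p 2) + dT t (Sum.inl (ν c 2, !σ c 2)) (Sum.inl (ν c 2, σ c 2)) := fun p => by
    have := i1 p; rw [c1, c1'] at this; linarith
  have j2 : ∀ p, gg ν σ t (x p 2) +
      dT t (Sum.inl (ν c 2, !σ c 2)) (Sum.inl (Fin.last (V+1), true)) <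
      gg ν σ t (x p 3) + dT t (Sum.inl (0, true)) (Sum.inl (Fin.last (V+1), true)) := fun p => by
    have := i2 p; rw [c2, c2'] at this; linarith
  have j3 : ∀ p, gg ν σ t (x p 3) + gg ν σ t (a (p+1) 0) +
      dT t (Sum.inl (0, true)) (Sum.inl (ν c 0, σ c 0)) < dT t (b p 3) (a (p+1) 0) := fun p => by
    have := i3 p; rw [c3] at this; linarith
  have j4 : ∀ p, gg ν σ t (b p 3) < gg ν σ t (a p 0) := fun p => by
    rw [ga, gb]; linarith [i4 p]
  have j5 : ∀ p, dT t (b (p+3) 3) (a p 0) < gg ν σ t (x p 0) + gg ν σ t (b (p+3) 3) +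
      dT t (Sum.inl (ν c 0, !σ c 0)) (Sum.inl (ν c 0, σ c 0)) := fun p => by
    have := i5 p; rw [c5, s5] at this; linarith
  have k1 := Finset.sum_lt_sum_of_nonempty (s := Finset.univ) Finset.univ_nonempty
    (fun p _ => j0 p)
  have k2 := Finset.sum_lt_sum_of_nonempty (s := Finset.univ) Finset.univ_nonempty
    (fun p _ => j1 p)
  have k3 := Finset.sum_lt_sum_of_nonempty (s := Finset.univ) Finset.univ_nonempty
    (fun p _ => j2 p)
  have k4 := Finset.sum_lt_sum_of_nonempty (s := Finset.univ) Finset.univ_nonempty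
    (fun p _ => j3 p)
  have k5 := Finset.sum_lt_sum_of_nonempty (s := Finset.univ) Finset.univ_nonempty
    (fun p _ => j4 p)
  have k6 := Finset.sum_lt_sum_of_nonempty (s := Finset.univ) Finset.univ_nonempty
    (fun p _ => j5 p)
  have r1 : ∑ p : Fin 4, gg ν σ t (a (p+1) 0) = ∑ p : Fin 4, gg ν σ t (a p 0) :=
    Equiv.sum_comp (Equiv.addRight (1 : Fin 4)) (fun p => gg ν σ t (a p 0))
  have r2 : ∑ p : Fin 4, gg ν σ t (b (p+3) 3) = ∑ p : Fin 4, gg ν σ t (b p 3) :=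
    Equiv.sum_comp (Equiv.addRight (3 : Fin 4)) (fun p => gg ν σ t (b p 3))
  have r3 : ∑ p : Fin 4, dT t (b (p+3) 3) (a p 0) = ∑ p : Fin 4, dT t (b p 3) (a (p+1) 0) := by
    rw [← Equiv.sum_comp (Equiv.addRight (1 : Fin 4)) (fun p => dT t (b (p+3) 3) (a p 0))]
    refine Finset.sum_congr rfl fun p _ => ?_
    have : p + 1 + 3 = p := by revert p; decide
    simp [Equiv.coe_addRight, this]
  simp only [Finset.sum_add_distrib, Finset.sum_const, Finset.card_univ, Fintype.card_fin,
    nsmul_eq_mul] at k1 k2 k3 k4 k5 k6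
  have S_0 := S 0
  have S_1 := S 1
  have S_2 := S 2
  have S1_0 := S1 0
  have S1_1 := S1 1
  have S1_2 := S1 2
  push_cast at *
  linarith
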